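/- Let V be a 4-dimensional complex vector space equipped with a nondegenerate alternating bilinear form ϖ, and let ϖ̃ : ⋀²V → ℂ be the induced linear functional. Suppose W ⊆ ⋀²V is a 2-dimensional subspace such that W ⊆ ker ϖ̃ and w ∧ w′ = 0 in ⋀⁴V for all w, w′ ∈ W. Then there exists a nonzero vector x ∈ V, unique up to a nonzero scalar multiple, such that W = {x ∧ v : v ∈ V, ϖ(x, v) = 0}. (This expresses that P³ is precisely the space of null lines in the quadric Q³: every projective line contained in Q³ is the fiber of π₀ over a unique point of P³.) -/

import Mathlib

open ExteriorAlgebra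

namespace ExteriorAlgebra

open CliffordAlgebra (contractLeft contractLeft_ι_mul contractLeft_ι)

variable {K V : Type*} [Field K] [AddCommGroup V] [Module K V]

theorem exteriorPower_two_induction {P : (w : ExteriorAlgebra K V) → w ∈ ⋀[K]^2 V → Prop}
    (hι : ∀ u v huv, P (ι K u * ι K v) huv)
    (hadd : ∀ w w' hw hw', P w hw → P w' hw' → P (w + w') (add_mem hw hw'))
    {w : ExteriorAlgebra K V} (hw : w ∈ ⋀[K]^2 V) : P w hw := by
  have hmul : ⋀[K]^2 V = LinearMap.range (ι K) * LinearMap.range (ι K) := pow_two _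
  suffices ∃ h, P w h from this.2
  rw [hmul] at hw
  induction hw using Submodule.mul_induction_on' with
  | mem_mul_mem m hm n hn =>
    obtain ⟨u, rfl⟩ := hm
    obtain ⟨v, rfl⟩ := hn
    exact ⟨hmul ▸ Submodule.mul_mem_mul ⟨u, rfl⟩ ⟨v, rfl⟩, hι u v _⟩
  | add w _ w' _ h h' => exact ⟨add_mem h.1 h'.1, hadd w w' _ _ h.2 h'.2⟩

theorem exists_contractLeft_eq_ι (d : Module.Dual K V) {w : ExteriorAlgebra K V}
    (hw : w ∈ ⋀[K]^2 V) : ∃ v : V, contractLeft d w = ι K v := by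
  induction hw using exteriorPower_two_induction with
  | hι u v _ =>
    refine ⟨d u • v - d v • u, ?_⟩
    rw [contractLeft_ι_mul, contractLeft_ι, ← Algebra.commutes, ← Algebra.smul_def]
    simp
  | hadd w w' _ _ h h' =>
    obtain ⟨v, hv⟩ := h
    obtain ⟨v', hv'⟩ := h'
    exact ⟨v + v', by simp [hv, hv']⟩

theorem contractLeft_mul_of_mem_two (d : Module.Dual K V) {w : ExteriorAlgebra K V}
    (hw : w ∈ ⋀[K]^2 V) (z : ExteriorAlgebra K V) :
    contractLeft d (w * z) = contractLeft d w * z + w * contractLeft d z := by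
  induction hw using exteriorPower_two_induction with
  | hι u v _ =>
    rw [mul_assoc, contractLeft_ι_mul, contractLeft_ι_mul, contractLeft_ι_mul, contractLeft_ι,
      ← Algebra.commutes, ← Algebra.smul_def]
    simp only [mul_sub, sub_mul, smul_mul_assoc, mul_smul_comm, mul_assoc]
    abel
  | hadd w w' _ _ h h' =>
    simp only [add_mul, map_add, h, h']
    abel

theorem ι_mul_ι_eq_neg (u v : V) : ι K u * ι K v = -(ι K v * ι K u) :=
  eq_neg_of_add_eq_zero_left (ι_add_mul_swap u v)

theorem mul_ι_comm_of_mem_two {w : ExteriorAlgebra K V} (hw : w ∈ ⋀[K]^2 V) (x : V) :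
    w * ι K x = ι K x * w := by
  induction hw using exteriorPower_two_induction with
  | hι u v _ =>
    rw [mul_assoc, ι_mul_ι_eq_neg v x, mul_neg, ← mul_assoc, ι_mul_ι_eq_neg u x, neg_mul, neg_neg,
      mul_assoc]
  | hadd w w' _ _ h h' => rw [add_mul, mul_add, h, h']

theorem eq_ι_mul_contractLeft {d : Module.Dual K V} {x : V} (hdx : d x = 1)
    {w : ExteriorAlgebra K V} (hxw : ι K x * w = 0) : w = ι K x * contractLeft d w := by
  have h := contractLeft_ι_mul (Q := (0 : QuadraticForm K V)) d x w
  rw [hxw, map_zero, hdx, one_smul] at h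
  exact sub_eq_zero.mp h.symm

theorem exists_eq_ι_mul_ι {x : V} (hx : x ≠ 0) {w : ExteriorAlgebra K V}
    (hw : w ∈ ⋀[K]^2 V) (hxw : ι K x * w = 0) : ∃ v : V, w = ι K x * ι K v := by
  obtain ⟨d, hd⟩ := Module.Projective.exists_dual_eq_one K hx
  obtain ⟨v, hv⟩ := exists_contractLeft_eq_ι d hw
  exact ⟨v, hv ▸ eq_ι_mul_contractLeft hd hxw⟩

theorem sum_ι_mul_contractLeft {I : Type*} [Fintype I] (b : Module.Basis I K V)
    {w : ExteriorAlgebra K V} (hw : w ∈ ⋀[K]^2 V) :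
    ∑ i, ι K (b i) * contractLeft (b.coord i) w = (2 : K) • w := by
  induction hw using exteriorPower_two_induction with
  | hι u v _ =>
    have hsum (v : V) : ∑ i, b.coord i v • ι K (b i) = ι K v := by
      conv_rhs => rw [← b.sum_repr v]
      simp only [map_sum, map_smul, Module.Basis.coord_apply]
    have hterm (i : I) : ι K (b i) * contractLeft (b.coord i) (ι K u * ι K v) =
        (b.coord i u • ι K (b i)) * ι K v - (b.coord i v • ι K (b i)) * ι K u := by
      rw [contractLeft_ι_mul, contractLeft_ι, ← Algebra.commutes, ← Algebra.smul_def]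
      simp [mul_sub]
    simp_rw [hterm]
    rw [Finset.sum_sub_distrib, ← Finset.sum_mul, ← Finset.sum_mul, hsum, hsum,
      ι_mul_ι_eq_neg v u, two_smul, sub_neg_eq_add]
  | hadd w w' _ _ h h' => simp only [map_add, mul_add, Finset.sum_add_distrib, h, h', smul_add]

theorem ιMulti_ne_zero_of_linearIndependent {n : ℕ} {v : Fin n → V} (hv : LinearIndependent K v) :
    ιMulti K n v ≠ 0 := by
  intro h
  have hli := exteriorPower.ιMulti_family_linearIndependent_field (n := n) hv
  refine hli.ne_zero (Set.powersetCard.ofFinEmbEquiv (RelEmbedding.refl _)) ?_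
  ext
  simpa [exteriorPower.ιMulti_family] using h

/-- Two nonzero decomposable 2-vectors with vanishing product have a common factor. -/
theorem exists_common_factor {a b c d : V} (hab : ι K a * ι K b ≠ 0) (hcd : ι K c * ι K d ≠ 0)
    (h : ι K a * ι K b * (ι K c * ι K d) = 0) :
    ∃ x : V, x ≠ 0 ∧ ι K x * (ι K a * ι K b) = 0 ∧ ι K x * (ι K c * ι K d) = 0 := by
  have hdep : ¬ LinearIndependent K ![a, b, c, d] := fun hli =>
    ιMulti_ne_zero_of_linearIndependent hli (by
      simpa [ιMulti_apply, List.ofFn_succ, mul_assoc] using h)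
  have hpair {u v : V} (huv : ι K u * ι K v ≠ 0) (p q : K) (hpq : p • u + q • v = 0) :
      p = 0 ∧ q = 0 := by
    have hp := congrArg (fun y => ι K y * ι K v) hpq
    have hq := congrArg (fun y => ι K u * ι K y) hpq
    simp [add_mul, mul_add, huv] at hp hq
    exact ⟨hp, hq⟩
  have hfactor (u v : V) (p q : K) : ι K (p • u + q • v) * (ι K u * ι K v) = 0 := by
    have : ι K v * (ι K u * ι K v) = 0 := by
      rw [← mul_assoc, ι_mul_ι_eq_neg v u, neg_mul, mul_assoc, ι_sq_zero, mul_zero, neg_zero]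
    simp [add_mul, this, ← mul_assoc (ι K u)]
  obtain ⟨g, hg, hg0⟩ : ∃ g : Fin 4 → K, ∑ i, g i • ![a, b, c, d] i = 0 ∧ ∃ i, g i ≠ 0 :=
    Fintype.not_linearIndependent_iff.mp hdep
  have hsum : (g 0 • a + g 1 • b) + (g 2 • c + g 3 • d) = 0 := by
    simpa [Fin.sum_univ_four, add_assoc] using hg
  refine ⟨g 0 • a + g 1 • b, ?_, hfactor a b _ _, ?_⟩
  · intro h0
    rw [h0, zero_add] at hsum
    obtain ⟨i, hi⟩ := hg0
    have h01 := hpair hab _ _ h0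
    have h23 := hpair hcd _ _ hsum
    fin_cases i
    exacts [hi h01.1, hi h01.2, hi h23.1, hi h23.2]
  · rw [eq_neg_of_add_eq_zero_left hsum, map_neg, neg_mul, hfactor, neg_zero]

/-- A 2-vector killed by two independent vectors is a multiple of their product. -/
theorem mem_span_of_ι_mul_eq_zero {x y : V} (hy : y ≠ 0) (hxy : x ∉ Submodule.span K {y})
    {w : ExteriorAlgebra K V} (hw : w ∈ ⋀[K]^2 V) (hxw : ι K x * w = 0) (hyw : ι K y * w = 0) :
    w ∈ Submodule.span K {ι K x * ι K y} := by
  obtain ⟨f, hfx, hfy⟩ := Submodule.exists_le_ker_of_notMem hxy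
  replace hfy : f y = 0 := hfy (Submodule.mem_span_singleton_self y)
  obtain ⟨v, rfl⟩ := exists_eq_ι_mul_ι hy hw hyw
  have h := congrArg (contractLeft f) hxw
  rw [contractLeft_ι_mul, contractLeft_ι_mul, hfy, contractLeft_ι, ← Algebra.commutes,
    ← Algebra.smul_def, map_zero, zero_smul, zero_sub, mul_neg, sub_neg_eq_add, mul_smul_comm] at h
  refine Submodule.mem_span_singleton.mpr ⟨-((f x)⁻¹ * f v), ?_⟩
  rw [neg_smul, mul_smul, eq_neg_of_add_eq_zero_right h, smul_neg, neg_neg, inv_smul_smul₀ hfx]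

variable [CharZero K] [FiniteDimensional K V]

theorem exists_contractLeft_ne_zero {w : ExteriorAlgebra K V} (hw : w ∈ ⋀[K]^2 V) (hw0 : w ≠ 0) :
    ∃ d : Module.Dual K V, contractLeft d w ≠ 0 := by
  by_contra! h
  have := sum_ι_mul_contractLeft (Module.finBasis K V) hw
  simp only [h, mul_zero, Finset.sum_const_zero] at this
  exact hw0 ((smul_eq_zero_iff_right two_ne_zero).mp this.symm)

/-- A 2-vector with vanishing square is decomposable. -/
theorem exists_eq_ι_mul_ι_of_mul_self_eq_zero {w : ExteriorAlgebra K V} (hw : w ∈ ⋀[K]^2 V)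
    (hww : w * w = 0) : ∃ u v : V, w = ι K u * ι K v := by
  rcases eq_or_ne w 0 with rfl | hw0
  · exact ⟨0, 0, by simp⟩
  obtain ⟨d, hd⟩ := exists_contractLeft_ne_zero hw hw0
  obtain ⟨x, hx⟩ := exists_contractLeft_eq_ι d hw
  have hx0 : x ≠ 0 := by
    rintro rfl
    simp [hx] at hd
  have h := contractLeft_mul_of_mem_two d hw w
  rw [hww, map_zero, hx, mul_ι_comm_of_mem_two hw, ← two_smul K] at h
  exact ⟨x, exists_eq_ι_mul_ι hx0 hw ((smul_eq_zero_iff_right two_ne_zero).mp h.symm)⟩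

end ExteriorAlgebra

/-- Let `V` be a 4-dimensional complex vector space with a nondegenerate
alternating bilinear form `ϖ`, and `ϖ̃` the induced linear functional on 2-vectors
(realized on the exterior algebra via `ϖ̃(u ∧ v) = ϖ(u, v)`). Suppose `W ⊆ ⋀²V` is a
2-dimensional subspace with `W ⊆ ker ϖ̃` and `w ∧ w′ = 0` for all `w, w′ ∈ W`. Then
there is a nonzero `x ∈ V`, unique up to a nonzero scalar, with
`W = {x ∧ v : v ∈ V, ϖ(x, v) = 0}`.
(Every projective line contained in the quadric `Q³` is the fiber of `π₀` over a
unique point of `P³`.) -/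
theorem stmt_7 {V : Type*} [AddCommGroup V] [Module ℂ V] [FiniteDimensional ℂ V]
    (ϖ : V →ₗ[ℂ] V →ₗ[ℂ] ℂ)
    (hdim : Module.finrank ℂ V = 4)
    (halt : ∀ v : V, ϖ v v = 0)
    (hnd : ∀ x : V, (∀ v : V, ϖ x v = 0) → x = 0)
    (ϖt : ExteriorAlgebra ℂ V →ₗ[ℂ] ℂ)
    (hϖt : ∀ u v : V, ϖt (ι ℂ u * ι ℂ v) = ϖ u v)
    (W : Submodule ℂ (ExteriorAlgebra ℂ V))
    (hW2 : Module.finrank ℂ W = 2)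
    (hWdeg : ∀ w ∈ W, w ∈ ⋀[ℂ]^2 V)
    (hWiso : ∀ w ∈ W, ϖt w = 0)
    (hWnull : ∀ w ∈ W, ∀ w' ∈ W, w * w' = 0) :
    ∃ x : V, x ≠ 0 ∧
      (W : Set (ExteriorAlgebra ℂ V)) = {w | ∃ v : V, ϖ x v = 0 ∧ w = ι ℂ x * ι ℂ v} ∧
      ∀ x' : V, x' ≠ 0 →
        (W : Set (ExteriorAlgebra ℂ V)) = {w | ∃ v : V, ϖ x' v = 0 ∧ w = ι ℂ x' * ι ℂ v} →
        ∃ c : ℂ, c ≠ 0 ∧ x' = c • x := by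
  have hfin : Module.Finite ℂ W := Module.finite_of_finrank_pos (by omega)
  let e := Module.finBasisOfFinrankEq ℂ W hW2
  have hne (i : Fin 2) : (e i : ExteriorAlgebra ℂ V) ≠ 0 := fun h => e.ne_zero i (Subtype.ext h)
  have hdec (i : Fin 2) := exists_eq_ι_mul_ι_of_mul_self_eq_zero (hWdeg _ (e i).2)
    (hWnull _ (e i).2 _ (e i).2)
  obtain ⟨a, b, hab⟩ := hdec 0
  obtain ⟨c, d, hcd⟩ := hdec 1
  obtain ⟨x, hx0, hx1, hx2⟩ := exists_common_factor (hab ▸ hne 0) (hcd ▸ hne 1)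
    (hab ▸ hcd ▸ hWnull _ (e 0).2 _ (e 1).2)
  have hxW (w) (hw : w ∈ W) : ι ℂ x * w = 0 := by
    have h := congrArg Subtype.val (e.sum_repr ⟨w, hw⟩)
    rw [Fin.sum_univ_two] at h
    simp only [Submodule.coe_add, Submodule.coe_smul, hab, hcd] at h
    rw [← h, mul_add, mul_smul_comm, mul_smul_comm, hx1, hx2, smul_zero, smul_zero, add_zero]
  let f : V →ₗ[ℂ] ExteriorAlgebra ℂ V := LinearMap.mulLeft ℂ (ι ℂ x) ∘ₗ ι ℂ
  let S := (LinearMap.ker (ϖ x)).map f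
  have hWS : W ≤ S := fun w hw => by
    obtain ⟨v, rfl⟩ := exists_eq_ι_mul_ι hx0 (hWdeg w hw) (hxW w hw)
    exact ⟨v, (hϖt x v).symm.trans (hWiso _ hw), rfl⟩
  have hS : Module.finrank ℂ S ≤ 2 := by
    have hϖx : ϖ x ≠ 0 := fun h => hx0 (hnd x fun v => by rw [h, LinearMap.zero_apply])
    have hker := Module.Dual.finrank_ker_add_one_of_ne_zero hϖx
    have hrn := (f.domRestrict (LinearMap.ker (ϖ x))).finrank_range_add_finrank_ker
    have hpos : 0 < Module.finrank ℂ (LinearMap.ker (f.domRestrict (LinearMap.ker (ϖ x)))) := by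
      rw [Module.finrank_pos_iff_exists_ne_zero]
      refine ⟨⟨⟨x, halt x⟩, ?_⟩, fun h => hx0 ?_⟩
      · exact ι_sq_zero x
      · exact congrArg (fun y => (y.1.1 : V)) h
    rw [LinearMap.range_domRestrict] at hrn
    change Module.finrank ℂ ((LinearMap.ker (ϖ x)).map f) ≤ 2
    omega
  have hWeq : W = S := Submodule.eq_of_le_of_finrank_le hWS (hS.trans hW2.ge)
  refine ⟨x, hx0, ?_, fun x' hx'0 hx' => ?_⟩
  · ext w
    rw [hWeq]
    exact exists_congr fun v => and_congr_right fun _ => eq_comm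
  · have hx'W (w) (hw : w ∈ W) : ι ℂ x' * w = 0 := by
      obtain ⟨v, -, rfl⟩ := hx'.subset hw
      rw [← mul_assoc, ι_sq_zero, zero_mul]
    by_cases hmem : x' ∈ Submodule.span ℂ {x}
    · obtain ⟨c, rfl⟩ := Submodule.mem_span_singleton.mp hmem
      exact ⟨c, fun hc => hx'0 (by rw [hc, zero_smul]), rfl⟩
    · have hle : W ≤ Submodule.span ℂ {ι ℂ x' * ι ℂ x} := fun w hw =>
        mem_span_of_ι_mul_eq_zero hx0 hmem (hWdeg w hw) (hx'W w hw) (hxW w hw)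
      have h1 := Submodule.finrank_mono hle
      have h2 := finrank_span_le_card (R := ℂ) {ι ℂ x' * ι ℂ x}
      simp only [Set.toFinset_singleton, Finset.card_singleton] at h2
      omega
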